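/- arXiv:1512.06520 — 3 statements merged into one kernel-verified Lean document; each statement's English description precedes it below -/
import Mathlib

section
/- (Inverse q-transform) Let s divide m, let β ∈ GF(q^s) ⊆ GF(q^m) generate a normal basis β, β^q, …, β^{q^{s−1}} of GF(q^s) over F_q, and let β⊥ ∈ GF(q^s) generate its dual normal basis, i.e. Tr_{GF(q^s)/F_q}(β^{q^k} · (β⊥)^{q^i}) = 1 if k = i and 0 otherwise, for all 0 ≤ k, i < s. Then for every linearized polynomial a over GF(q^m) with deg_q a < s (or a = 0), the coefficients of a are recovered from its q-transform by a_i = Σ_{j=0}^{s−1} a(β^{q^j}) · (β⊥)^{q^{j+i}} for all i = 0,…,s−1, where a_i denotes the coefficient of X^{q^i} in a. -/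
open Polynomial

/-- `a ∈ F[X]` is a linearized polynomial w.r.t. `q`: every exponent with a nonzero
coefficient is a power of `q`, i.e. `a = Σ_k a_k X^(q^k)`. -/
def IsLinearized (q : ℕ) {F : Type*} [Field F] (a : F[X]) : Prop :=
  ∀ k : ℕ, a.coeff k ≠ 0 → ∃ i : ℕ, k = q ^ i

/-- The `q`-degree of a linearized polynomial: the largest `k` such that the coefficient
of `X^(q^k)` is nonzero (for a nonzero linearized polynomial, `natDegree a = q ^ (qdeg q a)`). -/
noncomputable def qdeg (q : ℕ) {F : Type*} [Field F] (a : F[X]) : ℕ :=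
  Nat.log q a.natDegree

/-- `U ⊆ F` is an `F_q`-subspace of `F`, where `F_q = {β : F | β ^ q = β}` is the
subfield with `q` elements. -/
def IsQSubspace (q : ℕ) {F : Type*} [Field F] (U : Set F) : Prop :=
  (0 : F) ∈ U ∧ (∀ x ∈ U, ∀ y ∈ U, x + y ∈ U) ∧
    ∀ β x : F, β ^ q = β → x ∈ U → β * x ∈ U

/-- The `F_q`-linear span of a subset `A ⊆ F`, where `F_q = {β : F | β ^ q = β}`. -/
def qSpan (q : ℕ) {F : Type*} [Field F] (A : Set F) : Set F :=
  {x | ∃ t : Finset F, ↑t ⊆ A ∧ ∃ c : F → F, (∀ a : F, c a ^ q = c a) ∧ x = ∑ a ∈ t, c a * a}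

/-- The family `x` is linearly independent over `F_q = {β : F | β ^ q = β}`. -/
def QLinIndep (q : ℕ) {F : Type*} [Field F] {ι : Type*} [Fintype ι] (x : ι → F) : Prop :=
  ∀ c : ι → F, (∀ i, c i ^ q = c i) → ∑ i, c i * x i = 0 → ∀ i, c i = 0

/-- `M` is the minimal subspace polynomial of `U ⊆ F`: the (unique) nonzero monic
linearized polynomial of minimal degree whose set of roots in `F` is exactly `U`. -/
def IsMSP (q : ℕ) {F : Type*} [Field F] (U : Set F) (M : F[X]) : Prop :=
  IsLinearized q M ∧ M ≠ 0 ∧ M.Monic ∧ (∀ x : F, M.eval x = 0 ↔ x ∈ U) ∧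
    ∀ N : F[X], IsLinearized q N → N ≠ 0 → N.Monic → (∀ x : F, N.eval x = 0 ↔ x ∈ U) →
      M.natDegree ≤ N.natDegree

/-- `f : F → F` is `F_q`-linear, where `F_q = {β : F | β ^ q = β}`. -/
def IsQLinearMap (q : ℕ) {F : Type*} [Field F] (f : F → F) : Prop :=
  (∀ x y : F, f (x + y) = f x + f y) ∧ ∀ β x : F, β ^ q = β → f (β * x) = β * f x

/-- A linearized polynomial of degree less than `q ^ s` is evaluated by summing over the
exponents `q ^ k` with `k < s`. -/
lemma IsLinearized.eval_eq_sum_range {q s : ℕ} (hq : 1 < q) {F : Type*} [Field F] {a : F[X]}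
    (ha : IsLinearized q a) (hdeg : a.natDegree < q ^ s) (x : F) :
    a.eval x = ∑ k ∈ Finset.range s, a.coeff (q ^ k) * x ^ q ^ k := by
  rw [eval_eq_sum_range' hdeg,
    ← Finset.sum_image (g := fun k => q ^ k) (f := fun k => a.coeff k * x ^ k)
      (Nat.pow_right_injective hq).injOn]
  refine (Finset.sum_subset ?_ ?_).symm
  · intro k hk
    obtain ⟨i, hi, rfl⟩ := Finset.mem_image.1 hk
    exact Finset.mem_range.2 (Nat.pow_lt_pow_right hq (Finset.mem_range.1 hi))
  · intro k hk hk'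
    by_contra h
    obtain ⟨i, rfl⟩ := ha k (left_ne_zero_of_mul h)
    exact hk' (Finset.mem_image_of_mem _ (Finset.mem_range.2
      ((Nat.pow_lt_pow_iff_right hq).1 (Finset.mem_range.1 hk))))

/-- Inverse q-transform: if `s ∣ m`, `β` generates a normal basis
`β, β^q, …, β^(q^(s-1))` of `GF(q^s) ⊆ GF(q^m)` over `F_q`, and `βd` generates its dual
normal basis (i.e. `Tr_{GF(q^s)/F_q}(β^(q^k) · βd^(q^i)) = δ_{k i}` for `0 ≤ k, i < s`),
then for every linearized `a` with `deg_q a < s` (or `a = 0`) and every `i < s`,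
`a_i = Σ_{j=0}^{s-1} a(β^(q^j)) · βd^(q^(j+i))`. -/
theorem inverse_q_transform (p nn m q s : ℕ) [Fact (Nat.Prime p)] (hn : 0 < nn)
    (hm : 0 < m) (hq : q = p ^ nn) {F : Type*} [Field F] [Fintype F]
    (hF : Fintype.card F = q ^ m) (hs : s ∣ m) (β βd : F)
    (hβmem : β ^ q ^ s = β) (hβdmem : βd ^ q ^ s = βd)
    (hβindep : QLinIndep q fun j : Fin s => β ^ q ^ (j : ℕ))
    (hβspan : ∀ x : F, x ^ q ^ s = x →
      x ∈ qSpan q (Set.range fun j : Fin s => β ^ q ^ (j : ℕ)))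
    (hdual : ∀ k < s, ∀ i < s,
      (∑ l ∈ Finset.range s, (β ^ q ^ k * βd ^ q ^ i) ^ q ^ l) =
        if k = i then (1 : F) else 0) :
    ∀ a : F[X], IsLinearized q a → (a = 0 ∨ qdeg q a < s) →
      ∀ i < s, a.coeff (q ^ i) =
        ∑ j ∈ Finset.range s, a.eval (β ^ q ^ j) * βd ^ q ^ (j + i) := by
  intro a ha hdeg i hi
  have hq1 : 1 < q := hq ▸ Nat.one_lt_pow hn.ne' (Fact.out : p.Prime).one_lt
  have hdeg' : a.natDegree < q ^ s := by
    rcases hdeg with rfl | h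
    · simpa using Nat.pow_pos (n := s) (zero_lt_one.trans hq1)
    · exact Nat.lt_pow_of_log_lt hq1 h
  symm
  calc ∑ j ∈ Finset.range s, a.eval (β ^ q ^ j) * βd ^ q ^ (j + i)
      = ∑ j ∈ Finset.range s, ∑ k ∈ Finset.range s,
          a.coeff (q ^ k) * (β ^ q ^ k * βd ^ q ^ i) ^ q ^ j := by
        refine Finset.sum_congr rfl fun j _ => ?_
        rw [ha.eval_eq_sum_range hq1 hdeg', Finset.sum_mul]
        refine Finset.sum_congr rfl fun k _ => ?_
        rw [mul_pow, ← pow_mul, ← pow_mul, ← pow_mul, ← pow_add, ← pow_add, ← pow_add,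
          add_comm j k, add_comm j i, mul_assoc]
    _ = ∑ k ∈ Finset.range s, a.coeff (q ^ k) * if k = i then (1 : F) else 0 := by
        rw [Finset.sum_comm]
        refine Finset.sum_congr rfl fun k hk => ?_
        rw [← Finset.mul_sum, hdual k (Finset.mem_range.1 hk) i hi]
    _ = a.coeff (q ^ i) := by simp [hi]
end

section
/- (Interpolation recursion) Let s ≥ 2, let (x₁,y₁),…,(x_s,y_s) ∈ F × F with x₁,…,x_s linearly independent over F_q, where F = GF(q^m), and set h = ⌊s/2⌋. Let M₁ = M_{span(x₁,…,x_h)} and M₂ = M_{span(x_{h+1},…,x_s)}, and define x̃_i = M₂(x_i) for 1 ≤ i ≤ h and x̃_i = M₁(x_i) for h+1 ≤ i ≤ s. Then x̃₁,…,x̃_h are linearly independent over F_q, x̃_{h+1},…,x̃_s are linearly independent over F_q, and the interpolation polynomials satisfy I_{{(x_i,y_i)}_{i=1}^{s}} = I_{{(x̃_i,y_i)}_{i=1}^{h}} ∘ M₂ + I_{{(x̃_i,y_i)}_{i=h+1}^{s}} ∘ M₁. -/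
open Polynomial

/-- The subfield `{β : F | β ^ p ^ n = β}` of a field of characteristic `p`. -/
def frobeniusFixedSubfield (p n : ℕ) (F : Type*) [Field F] [ExpChar F p] : Subfield F :=
  (iterateFrobenius F p n).eqLocusField (RingHom.id F)

section

variable {p n : ℕ} {F : Type*} [Field F] [ExpChar F p]

theorem mem_frobeniusFixedSubfield {β : F} :
    β ∈ frobeniusFixedSubfield p n F ↔ β ^ p ^ n = β :=
  Iff.rfl

theorem qSpan_eq_span (A : Set F) :
    qSpan (p ^ n) A = Submodule.span (frobeniusFixedSubfield p n F) A := by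
  ext z
  simp only [qSpan, Set.mem_ofPred_eq, SetLike.mem_coe]
  constructor
  · rintro ⟨t, ht, c, hc, rfl⟩
    exact sum_mem fun a ha => Submodule.smul_mem _
      (⟨c a, mem_frobeniusFixedSubfield.2 (hc a)⟩ : frobeniusFixedSubfield p n F)
      (Submodule.subset_span (ht ha))
  · rw [Submodule.mem_span_iff_exists_finset_subset]
    rintro ⟨f, t, ht, -, rfl⟩
    exact ⟨t, ht, fun a => f a, fun a => (f a).2, rfl⟩

theorem qLinIndep_iff_linearIndependent {ι : Type*} [Fintype ι] {x : ι → F} :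
    QLinIndep (p ^ n) x ↔ LinearIndependent (frobeniusFixedSubfield p n F) x := by
  rw [Fintype.linearIndependent_iff]
  constructor
  · intro h g hg i
    exact Subtype.ext (h (fun i => g i) (fun i => (g i).2) hg i)
  · intro h c hc hsum i
    exact congrArg Subtype.val (h (fun i => ⟨c i, hc i⟩) hsum i)

namespace IsLinearized

theorem add {q : ℕ} {a b : F[X]} (ha : IsLinearized q a) (hb : IsLinearized q b) :
    IsLinearized q (a + b) := by
  intro k hk
  by_cases h : a.coeff k = 0
  · exact hb k fun h' => hk (by simp [h, h'])
  · exact ha k h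

theorem C_mul {q : ℕ} {a : F[X]} (ha : IsLinearized q a) (c : F) :
    IsLinearized q (C c * a) := by
  intro k hk
  exact ha k fun h' => hk (by simp [h'])

theorem pow_frobenius {a : F[X]} (ha : IsLinearized (p ^ n) a) :
    IsLinearized (p ^ n) (a ^ p ^ n) := by
  intro k hk
  have hp : 0 < p ^ n := pow_pos (expChar_pos F p) n
  rw [← map_iterateFrobenius_expand, coeff_map, coeff_expand hp] at hk
  split_ifs at hk with hd
  · obtain ⟨j, rfl⟩ := hd
    rw [Nat.mul_div_cancel_left _ hp] at hk
    obtain ⟨i, rfl⟩ := ha j fun h' => hk (by rw [h', map_zero])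
    exact ⟨i + 1, by rw [pow_succ' (p ^ n)]⟩
  · simp at hk

theorem eval_add' {a : F[X]} (ha : IsLinearized (p ^ n) a) (x y : F) :
    a.eval (x + y) = a.eval x + a.eval y := by
  simp only [eval_eq_sum, Polynomial.sum, ← Finset.sum_add_distrib]
  refine Finset.sum_congr rfl fun k hk => ?_
  obtain ⟨i, rfl⟩ := ha k (mem_support_iff.1 hk)
  rw [← pow_mul, add_pow_expChar_pow, mul_add]

theorem eval_smul' {a : F[X]} (ha : IsLinearized (p ^ n) a)
    (β : frobeniusFixedSubfield p n F) (x : F) :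
    a.eval (β • x) = β • a.eval x := by
  have hβ (i : ℕ) : (β : F) ^ (p ^ n) ^ i = β := by
    induction i with
    | zero => simp
    | succ i ih => rw [pow_succ, pow_mul, ih, mem_frobeniusFixedSubfield.1 β.2]
  simp only [Subfield.smul_def, smul_eq_mul, eval_eq_sum, Polynomial.sum, Finset.mul_sum]
  refine Finset.sum_congr rfl fun k hk => ?_
  obtain ⟨i, rfl⟩ := ha k (mem_support_iff.1 hk)
  rw [mul_pow, hβ]
  ring

/-- Evaluation of a linearized polynomial, as a linear map over the fixed subfield of `x ↦ x ^ q`. -/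
def evalLinearMap {a : F[X]} (ha : IsLinearized (p ^ n) a) :
    F →ₗ[frobeniusFixedSubfield p n F] F where
  toFun x := a.eval x
  map_add' := ha.eval_add'
  map_smul' := ha.eval_smul'

@[simp]
theorem evalLinearMap_apply {a : F[X]} (ha : IsLinearized (p ^ n) a) (x : F) :
    ha.evalLinearMap x = a.eval x :=
  rfl

end IsLinearized

theorem exists_isLinearized_roots_eq_span (hq : 1 < p ^ n) (t : Finset F) :
    ∃ N : F[X], IsLinearized (p ^ n) N ∧ N.Monic ∧ N.natDegree ≤ (p ^ n) ^ t.card ∧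
      ∀ z, N.eval z = 0 ↔ z ∈ Submodule.span (frobeniusFixedSubfield p n F) (t : Set F) := by
  classical
  induction t using Finset.induction_on with
  | empty =>
    refine ⟨X, fun k hk => ⟨0, ?_⟩, monic_X, by simp, by simp⟩
    rw [coeff_X] at hk
    by_contra h
    exact hk (if_neg fun h' => h (by simp [← h']))
  | insert a t hat ih =>
    obtain ⟨N, hlin, hmonic, hdeg, hroots⟩ := ih
    rw [Finset.card_insert_of_notMem hat]
    simp only [Finset.coe_insert]
    by_cases ha : N.eval a = 0
    · refine ⟨N, hlin, hmonic, hdeg.trans (Nat.pow_le_pow_right hq.le (Nat.le_succ _)), ?_⟩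
      intro z
      rw [hroots, Submodule.span_insert_eq_span ((hroots a).1 ha)]
    have hpos : 0 < N.natDegree := by
      by_contra h
      have h1 : N = 1 := hmonic.natDegree_eq_zero.1 (by omega)
      have := (hroots 0).2 (Submodule.zero_mem _)
      simp [h1] at this
    have hlt : (C (-N.eval a ^ (p ^ n - 1)) * N).degree < (N ^ p ^ n).degree := by
      refine degree_lt_degree ((natDegree_C_mul_le _ _).trans_lt ?_)
      rw [hmonic.natDegree_pow]
      exact lt_mul_of_one_lt_left hpos hq
    refine ⟨N ^ p ^ n + C (-N.eval a ^ (p ^ n - 1)) * N,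
      hlin.pow_frobenius.add (hlin.C_mul _), (hmonic.pow _).add_of_left hlt, ?_, fun z => ?_⟩
    · rw [natDegree_add_eq_left_of_degree_lt hlt, hmonic.natDegree_pow, pow_succ']
      exact Nat.mul_le_mul_left _ hdeg
    have hsucc (w : F) : w ^ p ^ n = w ^ (p ^ n - 1) * w := by
      rw [← pow_succ, Nat.sub_add_cancel hq.le]
    rw [Submodule.mem_span_insert']
    simp only [eval_add, eval_mul, eval_C, eval_pow, ← hroots, hlin.eval_add', hlin.eval_smul']
    simp only [Subfield.smul_def, smul_eq_mul]
    constructor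
    · intro h
      refine ⟨⟨-(N.eval z / N.eval a), neg_mem (mem_frobeniusFixedSubfield.2 ?_)⟩, ?_⟩
      · rw [div_pow, div_eq_div_iff (pow_ne_zero _ ha) ha, hsucc (N.eval a)]
        linear_combination N.eval a * h
      · simp [ha]
    · rintro ⟨β, hβ⟩
      have hz : N.eval z = ((-β : frobeniusFixedSubfield p n F) : F) * N.eval a := by
        push_cast
        linear_combination hβ
      rw [hz, mul_pow, mem_frobeniusFixedSubfield.1 (-β).2, hsucc (N.eval a)]
      ring

theorem IsMSP.natDegree_le {t : Finset F} {M : F[X]} (hq : 1 < p ^ n)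
    (hM : IsMSP (p ^ n) (qSpan (p ^ n) (t : Set F)) M) : M.natDegree ≤ (p ^ n) ^ t.card := by
  obtain ⟨N, hlin, hmonic, hdeg, hroots⟩ := exists_isLinearized_roots_eq_span hq t
  refine (hM.2.2.2.2 N hlin hmonic.ne_zero hmonic fun z => ?_).trans hdeg
  rw [hroots, qSpan_eq_span, SetLike.mem_coe]

theorem le_card_frobeniusFixedSubfield [Fintype F] {m : ℕ} (hq : 1 < p ^ n)
    (hF : Fintype.card F = (p ^ n) ^ m) : p ^ n ≤ Nat.card (frobeniusFixedSubfield p n F) := by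
  classical
  obtain ⟨g, hg⟩ := IsCyclic.exists_ofOrder_eq_natCard (α := Fˣ)
  have hcard : Nat.card Fˣ = (p ^ n) ^ m - 1 := by
    rw [Nat.card_eq_fintype_card, Fintype.card_units, hF]
  obtain ⟨d, hd⟩ : p ^ n - 1 ∣ orderOf g := by
    rw [hg, hcard]
    simpa using Nat.sub_dvd_pow_sub_pow (p ^ n) 1 m
  have hord : orderOf (g ^ d) = p ^ n - 1 := by
    have hd0 : d ≠ 0 := by
      rintro rfl
      exact (orderOf_pos g).ne' (by simpa using hd)
    rw [orderOf_pow_of_dvd hd0 ⟨p ^ n - 1, by rw [hd, mul_comm]⟩, hd,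
      Nat.mul_div_cancel _ (Nat.pos_of_ne_zero hd0)]
  have hprim : IsPrimitiveRoot ((g ^ d : Fˣ) : F) (p ^ n - 1) := by
    rw [← hord]
    exact IsPrimitiveRoot.coe_units_iff.2 (IsPrimitiveRoot.orderOf _)
  have hpos : 0 < p ^ n - 1 := by omega
  have h0 : (0 : F) ∉ nthRootsFinset (p ^ n - 1) (1 : F) := by
    rw [mem_nthRootsFinset hpos, zero_pow hpos.ne']
    exact zero_ne_one
  calc p ^ n = (insert 0 (nthRootsFinset (p ^ n - 1) (1 : F))).card := by
        rw [Finset.card_insert_of_notMem h0, hprim.card_nthRootsFinset, Nat.sub_add_cancel hq.le]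
    _ = (insert 0 (nthRootsFinset (p ^ n - 1) (1 : F)) : Set F).ncard := by
        rw [← Set.ncard_coe_finset, Finset.coe_insert]
    _ ≤ (frobeniusFixedSubfield p n F : Set F).ncard := by
        refine Set.ncard_le_ncard ?_ (Set.toFinite _)
        rintro z (rfl | hz)
        · exact zero_mem _
        · rw [Finset.mem_coe, mem_nthRootsFinset hpos] at hz
          rw [SetLike.mem_coe, mem_frobeniusFixedSubfield, ← Nat.sub_add_cancel hq.le, pow_succ,
            hz, one_mul]
    _ = _ := rfl

/-- A polynomial of small degree inducing a linear map that vanishes on an independent family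
is zero. -/
theorem eq_zero_of_natDegree_lt_of_linearIndependent [Fintype F] {m s : ℕ} (hq : 1 < p ^ n)
    (hF : Fintype.card F = (p ^ n) ^ m) {x : Fin s → F}
    (hx : LinearIndependent (frobeniusFixedSubfield p n F) x) {D : F[X]}
    (f : F →ₗ[frobeniusFixedSubfield p n F] F) (hf : ∀ z, f z = D.eval z)
    (hD : D.natDegree < (p ^ n) ^ s) (hzero : ∀ i, D.eval (x i) = 0) : D = 0 := by
  classical
  let V := Submodule.span (frobeniusFixedSubfield p n F) (Set.range x)
  have hker : V ≤ LinearMap.ker f := by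
    rw [Submodule.span_le]
    rintro _ ⟨i, rfl⟩
    simp [hf, hzero]
  refine eq_zero_of_natDegree_lt_card_of_eval_eq_zero' D (V : Set F).toFinset (fun z hz => ?_)
    (hD.trans_le ?_)
  · rw [← hf]
    exact hker (by simpa using hz)
  · have hV : Nat.card V = Nat.card (frobeniusFixedSubfield p n F) ^ s := by
      rw [Module.natCard_eq_pow_finrank (K := frobeniusFixedSubfield p n F),
        finrank_span_eq_card hx, Fintype.card_fin]
    rw [Set.toFinset_card, ← Nat.card_eq_fintype_card]
    exact (Nat.pow_le_pow_left (le_card_frobeniusFixedSubfield hq hF) s).trans_eq hV.symm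

theorem eq_zero_of_sum_mul_eval_eq_zero {ι : Type*} [Fintype ι] {x : ι → F}
    (hx : LinearIndependent (frobeniusFixedSubfield p n F) x) {T : Set ι} {M : F[X]}
    (hM : IsMSP (p ^ n) (qSpan (p ^ n) (x '' T)) M) {c : ι → F} (hc : ∀ i, c i ^ p ^ n = c i)
    (hcT : ∀ i ∈ T, c i = 0) (hsum : ∑ i, c i * M.eval (x i) = 0) (i : ι) : c i = 0 := by
  let c' (i : ι) : frobeniusFixedSubfield p n F := ⟨c i, hc i⟩
  have hroot : ∑ i, c' i • x i ∈ Submodule.span (frobeniusFixedSubfield p n F) (x '' T) := by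
    rw [← SetLike.mem_coe, ← qSpan_eq_span, ← hM.2.2.2.1, ← hM.1.evalLinearMap_apply]
    simp only [map_sum, map_smul, IsLinearized.evalLinearMap_apply]
    exact hsum
  have hcompl : ∑ i, c' i • x i ∈ Submodule.span (frobeniusFixedSubfield p n F) (x '' Tᶜ) := by
    refine sum_mem fun i _ => ?_
    by_cases hi : i ∈ T
    · have : c' i = 0 := Subtype.ext (hcT i hi)
      simp [this]
    · exact Submodule.smul_mem _ _ (Submodule.subset_span ⟨i, hi, rfl⟩)
  have hzero := Submodule.disjoint_def.1 (hx.disjoint_span_image disjoint_compl_right) _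
    hroot hcompl
  exact congrArg Subtype.val (Fintype.linearIndependent_iff.1 hx c' hzero i)

theorem natDegree_lt_of_qdeg_lt {q k : ℕ} (hq : 1 < q) {a : F[X]} (ha : a = 0 ∨ qdeg q a < k) :
    a.natDegree < q ^ k := by
  rcases ha with rfl | ha
  · simpa using pow_pos (zero_lt_one.trans hq) k
  · exact Nat.lt_pow_of_log_lt hq ha

end

/-- Interpolation recursion: with `h = ⌊s/2⌋`, `M₁ = M_{span(x₁,…,x_h)}`,
`M₂ = M_{span(x_{h+1},…,x_s)}` and `x̃_i = M₂(x_i)` for `i ≤ h`, `x̃_i = M₁(x_i)` for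
`i > h`, the families `(x̃_i)_{i ≤ h}` and `(x̃_i)_{i > h}` are each linearly independent
over `F_q`, and the interpolation polynomials satisfy
`I_{(x_i,y_i)_{i=1}^s} = I_{(x̃_i,y_i)_{i=1}^h} ∘ M₂ + I_{(x̃_i,y_i)_{i=h+1}^s} ∘ M₁`. -/
theorem interpolation_recursion (p nn m q s : ℕ) [Fact (Nat.Prime p)] (hn : 0 < nn)
    (hm : 0 < m) (hq : q = p ^ nn) {F : Type*} [Field F] [Fintype F]
    (hF : Fintype.card F = q ^ m) (hs : 2 ≤ s)
    (x y : Fin s → F) (hx : QLinIndep q x) (h : ℕ) (hh : h = s / 2)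
    (M₁ M₂ : F[X])
    (hM₁ : IsMSP q (qSpan q {z : F | ∃ i : Fin s, (i : ℕ) < h ∧ z = x i}) M₁)
    (hM₂ : IsMSP q (qSpan q {z : F | ∃ i : Fin s, h ≤ (i : ℕ) ∧ z = x i}) M₂)
    (xt : Fin s → F)
    (hxt : ∀ i : Fin s, xt i = if (i : ℕ) < h then M₂.eval (x i) else M₁.eval (x i))
    (I₁ I₂ : F[X])
    (hI₁lin : IsLinearized q I₁) (hI₁deg : I₁ = 0 ∨ qdeg q I₁ < h)
    (hI₁eval : ∀ i : Fin s, (i : ℕ) < h → I₁.eval (xt i) = y i)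
    (hI₂lin : IsLinearized q I₂) (hI₂deg : I₂ = 0 ∨ qdeg q I₂ < s - h)
    (hI₂eval : ∀ i : Fin s, h ≤ (i : ℕ) → I₂.eval (xt i) = y i) :
    (∀ c : Fin s → F, (∀ i, c i ^ q = c i) → (∀ i : Fin s, ¬ (i : ℕ) < h → c i = 0) →
      ∑ i, c i * xt i = 0 → ∀ i, c i = 0) ∧
    (∀ c : Fin s → F, (∀ i, c i ^ q = c i) → (∀ i : Fin s, (i : ℕ) < h → c i = 0) →
      ∑ i, c i * xt i = 0 → ∀ i, c i = 0) ∧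
    ∀ I : F[X], IsLinearized q I → (I = 0 ∨ qdeg q I < s) →
      (∀ i : Fin s, I.eval (x i) = y i) →
      I = I₁.comp M₂ + I₂.comp M₁ := by
  classical
  subst hq
  have hp : p.Prime := Fact.out
  have hq : 1 < p ^ nn := Nat.one_lt_pow hn.ne' hp.one_lt
  have : CharP F p := charP_of_card_eq_prime_pow (f := nn * m) (by rw [hF, pow_mul])
  have : ExpChar F p := ExpChar.prime hp
  have hli := qLinIndep_iff_linearIndependent.1 hx
  have hxt₁ (i : Fin s) (hi : (i : ℕ) < h) : xt i = M₂.eval (x i) := by rw [hxt, if_pos hi]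
  have hxt₂ (i : Fin s) (hi : h ≤ (i : ℕ)) : xt i = M₁.eval (x i) := by
    rw [hxt, if_neg hi.not_gt]
  have hset₁ : {z : F | ∃ i : Fin s, (i : ℕ) < h ∧ z = x i} = x '' {i | (i : ℕ) < h} := by
    ext z
    simp [eq_comm]
  have hset₂ : {z : F | ∃ i : Fin s, h ≤ (i : ℕ) ∧ z = x i} = x '' {i | h ≤ (i : ℕ)} := by
    ext z
    simp [eq_comm]
  rw [hset₁] at hM₁
  rw [hset₂] at hM₂
  refine ⟨fun c hc hc0 hsum => ?_, fun c hc hc0 hsum => ?_, fun I hI hIdeg hIeval => ?_⟩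
  · refine eq_zero_of_sum_mul_eval_eq_zero hli hM₂ hc (fun i hi => hc0 i (not_lt.2 hi)) ?_
    rw [← hsum]
    refine Finset.sum_congr rfl fun i _ => ?_
    by_cases hi : (i : ℕ) < h
    · rw [hxt₁ i hi]
    · simp [hc0 i hi]
  · refine eq_zero_of_sum_mul_eval_eq_zero hli hM₁ hc hc0 ?_
    rw [← hsum]
    refine Finset.sum_congr rfl fun i _ => ?_
    by_cases hi : (i : ℕ) < h
    · simp [hc0 i hi]
    · rw [hxt₂ i (not_lt.1 hi)]
  · have hdeg₁ : M₁.natDegree ≤ (p ^ nn) ^ h := by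
      rw [← Set.coe_toFinset {i : Fin s | (i : ℕ) < h}, ← Finset.coe_image] at hM₁
      refine (hM₁.natDegree_le hq).trans
        (Nat.pow_le_pow_right hq.le (Finset.card_image_le.trans ?_))
      simpa using Finset.card_le_card_of_injOn (t := Finset.range h) Fin.val
        (fun i hi => by simpa using hi) Fin.val_injective.injOn
    have hdeg₂ : M₂.natDegree ≤ (p ^ nn) ^ (s - h) := by
      rw [← Set.coe_toFinset {i : Fin s | h ≤ (i : ℕ)}, ← Finset.coe_image] at hM₂
      refine (hM₂.natDegree_le hq).trans
        (Nat.pow_le_pow_right hq.le (Finset.card_image_le.trans ?_))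
      simpa using Finset.card_le_card_of_injOn (t := Finset.Ico h s) Fin.val
        (fun i hi => by simpa using hi) Fin.val_injective.injOn
    have hqpos (k : ℕ) : 0 < (p ^ nn) ^ k := pow_pos (zero_lt_one.trans hq) k
    have hle : h ≤ s := by omega
    have hcomp₁ : (I₁.comp M₂).natDegree < (p ^ nn) ^ s := by
      rw [natDegree_comp, ← Nat.add_sub_of_le hle, pow_add]
      refine Nat.mul_lt_mul_of_lt_of_le (natDegree_lt_of_qdeg_lt hq hI₁deg) ?_ (hqpos _)
      simpa [Nat.add_sub_of_le hle] using hdeg₂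
    have hcomp₂ : (I₂.comp M₁).natDegree < (p ^ nn) ^ s := by
      rw [natDegree_comp, ← Nat.sub_add_cancel hle, pow_add]
      refine Nat.mul_lt_mul_of_lt_of_le ?_ hdeg₁ (hqpos _)
      simpa [Nat.sub_add_cancel hle] using natDegree_lt_of_qdeg_lt hq hI₂deg
    rw [← sub_eq_zero]
    refine eq_zero_of_natDegree_lt_of_linearIndependent hq hF hli
      (hI.evalLinearMap - (hI₁lin.evalLinearMap ∘ₗ hM₂.1.evalLinearMap +
        hI₂lin.evalLinearMap ∘ₗ hM₁.1.evalLinearMap)) (fun z => by simp) ?_ fun i => ?_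
    · exact (natDegree_sub_le _ _).trans_lt (max_lt (natDegree_lt_of_qdeg_lt hq hIdeg)
        ((natDegree_add_le _ _).trans_lt (max_lt hcomp₁ hcomp₂)))
    · have hI₁0 : I₁.eval 0 = 0 := hI₁lin.evalLinearMap.map_zero
      have hI₂0 : I₂.eval 0 = 0 := hI₂lin.evalLinearMap.map_zero
      simp only [eval_sub, eval_add, eval_comp, hIeval]
      rcases lt_or_ge (i : ℕ) h with hi | hi
      · have hroot : M₁.eval (x i) = 0 := by
          rw [hM₁.2.2.2.1, qSpan_eq_span]
          exact Submodule.subset_span ⟨i, hi, rfl⟩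
        rw [hroot, ← hxt₁ i hi, hI₁eval i hi, hI₂0]
        ring
      · have hroot : M₂.eval (x i) = 0 := by
          rw [hM₂.2.2.2.1, qSpan_eq_span]
          exact Submodule.subset_span ⟨i, hi, rfl⟩
        rw [hroot, ← hxt₂ i hi, hI₂eval i hi, hI₁0]
        ring
end

section
/- (Fragmentation identity underlying the fast multiplication algorithm) Let a and b be linearized polynomials over F = GF(q^m) with deg_q a, deg_q b ≤ s, let s* = ⌈√(s+1)⌉, and for 0 ≤ i ≤ s*−1 define the fragment a^{(i)} = Σ_{j=0}^{s*−1} a_{i·s*+j} X^{q^{i·s*+j}}, where a_k denotes the coefficient of X^{q^k} in a. Then a ∘ b = Σ_{i=0}^{s*−1} a^{(i)} ∘ b, and writing c^{(i)}_h for the coefficient of X^{q^{i·s*+h}} in a^{(i)} ∘ b (for 0 ≤ h ≤ s + s*−1), one has σ^{−i·s*}(c^{(i)}_h) = Σ_{j=0}^{h} σ^{−i·s*}(a_{i·s*+j}) · σ^{j}(b_{h−j}), where σ : F → F, x ↦ x^q, is the Frobenius automorphism, σ^{−k} denotes the k-th iterate of its inverse, and b_{h−j} is taken to be 0 when h − j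 > s. -/
open Polynomial

/-- The `i`-th fragment `a^(i) = Σ_{j=0}^{s*-1} a_{i·s*+j} X^(q^(i·s*+j))` of a
linearized polynomial `a`. -/
noncomputable def qFragment (q sstar : ℕ) {F : Type*} [Field F] (a : F[X]) (i : ℕ) :
    F[X] :=
  ∑ j ∈ Finset.range sstar, monomial (q ^ (i * sstar + j)) (a.coeff (q ^ (i * sstar + j)))


theorem coeff_pow_char_pow_mul {F : Type*} [Field F] (p n : ℕ) [Fact p.Prime] [CharP F p]
    (b : F[X]) (l : ℕ) :
    (b ^ p ^ n).coeff (p ^ n * l) = b.coeff l ^ p ^ n := by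
  rw [← Polynomial.map_iterateFrobenius_expand p b n, coeff_map,
    coeff_expand_mul' (pow_pos (Fact.out : p.Prime).pos n), iterateFrobenius_def]

theorem coeff_pow_char_pow_of_not_dvd {F : Type*} [Field F] (p n : ℕ) [Fact p.Prime]
    [CharP F p] (b : F[X]) {l : ℕ} (hl : ¬ p ^ n ∣ l) :
    (b ^ p ^ n).coeff l = 0 := by
  rw [← Polynomial.map_iterateFrobenius_expand p b n, coeff_map,
    coeff_expand (pow_pos (Fact.out : p.Prime).pos n), if_neg hl, map_zero]

theorem coeff_pow_qpow {F : Type*} [Field F] (p n : ℕ) [Fact p.Prime] [CharP F p] (hn : 0 < n)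
    (b : F[X]) (k l : ℕ) :
    (b ^ (p ^ n) ^ k).coeff ((p ^ n) ^ l) =
      if k ≤ l then b.coeff ((p ^ n) ^ (l - k)) ^ (p ^ n) ^ k else 0 := by
  split_ifs with hkl
  · obtain ⟨d, rfl⟩ := Nat.exists_eq_add_of_le hkl
    rw [Nat.add_sub_cancel_left, pow_add, ← pow_mul p n k, coeff_pow_char_pow_mul]
  · rw [← pow_mul p n k]
    refine coeff_pow_char_pow_of_not_dvd p _ b fun hdvd => hkl ?_
    rw [pow_mul] at hdvd
    exact (Nat.pow_dvd_pow_iff_le_right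
      (Nat.one_lt_pow hn.ne' (Fact.out : p.Prime).one_lt)).1 hdvd

theorem IsLinearized.eq_sum_monomial {q N : ℕ} (hq : 1 < q) {F : Type*} [Field F] {a : F[X]}
    (ha : IsLinearized q a) (hN : a.natDegree < q ^ N) :
    a = ∑ k ∈ Finset.range N, monomial (q ^ k) (a.coeff (q ^ k)) := by
  ext d
  simp only [finsetSum_coeff, coeff_monomial]
  by_cases hd : a.coeff d = 0
  · refine hd.trans (Finset.sum_eq_zero fun k _ => ?_).symm
    split_ifs with h
    · rw [h, hd]
    · rfl
  · obtain ⟨i, rfl⟩ := ha d hd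
    have hi : i < N := (Nat.pow_lt_pow_iff_right hq).1 ((le_natDegree_of_ne_zero hd).trans_lt hN)
    simp [Nat.pow_right_inj hq, hi]

theorem sum_range_qFragment (q t n : ℕ) {F : Type*} [Field F] (a : F[X]) :
    ∑ i ∈ Finset.range n, qFragment q t a i =
      ∑ k ∈ Finset.range (n * t), monomial (q ^ k) (a.coeff (q ^ k)) := by
  induction n with
  | zero => simp
  | succ n ih => rw [Finset.sum_range_succ, ih, Nat.succ_mul, Finset.sum_range_add, qFragment]

theorem coeff_qFragment {q : ℕ} (hq : 1 < q) (t : ℕ) {F : Type*} [Field F] (a : F[X])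
    (i j : ℕ) :
    (qFragment q t a i).coeff (q ^ (i * t + j)) =
      if j < t then a.coeff (q ^ (i * t + j)) else 0 := by
  simp [qFragment, finsetSum_coeff, coeff_monomial, Nat.pow_right_inj hq]

theorem coeff_qFragment_comp {F : Type*} [Field F] (p n : ℕ) [Fact p.Prime] [CharP F p]
    (hn : 0 < n) (t : ℕ) (a b : F[X]) (i h : ℕ) :
    ((qFragment (p ^ n) t a i).comp b).coeff ((p ^ n) ^ (i * t + h)) =
      ∑ j ∈ Finset.range (h + 1), (qFragment (p ^ n) t a i).coeff ((p ^ n) ^ (i * t + j)) *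
        b.coeff ((p ^ n) ^ (h - j)) ^ (p ^ n) ^ (i * t + j) := by
  simp only [coeff_qFragment (Nat.one_lt_pow hn.ne' (Fact.out : p.Prime).one_lt)]
  simp only [qFragment, Polynomial.sum_comp, monomial_comp, finsetSum_coeff, coeff_C_mul,
    coeff_pow_qpow p n hn, add_le_add_iff_left, Nat.add_sub_add_left, ite_mul, zero_mul, mul_ite,
    mul_zero]
  rw [← Finset.sum_filter, ← Finset.sum_filter]
  refine Finset.sum_congr ?_ fun _ _ => rfl
  ext j
  simp only [Finset.mem_filter, Finset.mem_range]
  omega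

theorem iterate_pow_qpow {F : Type*} [Monoid F] {q : ℕ} {τ : F → F} (hτ : ∀ x, τ x ^ q = x)
    (k : ℕ) (x : F) : (τ^[k] x) ^ q ^ k = x := by
  induction k generalizing x with
  | zero => simp
  | succ k ih => rw [Function.iterate_succ_apply', pow_succ', pow_mul, hτ, ih]

/-- Fragmentation identity: for linearized `a, b` of `q`-degree `≤ s`
(i.e. `natDegree ≤ q^s`) and `s* = ⌈√(s+1)⌉`, one has `a ∘ b = Σ_i a^(i) ∘ b`, and for
`i < s*` and `h ≤ s + s* - 1`, writing `c^(i)_h` for the coefficient of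
`X^(q^(i·s*+h))` in `a^(i) ∘ b` and `σ^{-1} = τ` for the inverse Frobenius,
`σ^(-i·s*)(c^(i)_h) = Σ_{j=0}^{h} σ^(-i·s*)(a^(i)_{i·s*+j}) · σ^j(b_{h-j})`
(the coefficients of `a^(i)` beyond the fragment, as well as `b_{h-j}` for `h - j > s`,
being zero). -/
theorem fragmentation_identity (p nn m q s sstar : ℕ) [Fact (Nat.Prime p)] (hn : 0 < nn)
    (hm : 0 < m) (hq : q = p ^ nn) {F : Type*} [Field F] [Fintype F]
    (hF : Fintype.card F = q ^ m)
    (a b : F[X]) (ha : IsLinearized q a) (hb : IsLinearized q b)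
    (hda : a.natDegree ≤ q ^ s) (hdb : b.natDegree ≤ q ^ s)
    (hsstar : s + 1 ≤ sstar ^ 2 ∧ ∀ t : ℕ, s + 1 ≤ t ^ 2 → sstar ≤ t)
    (τ : F → F) (hτ : ∀ x : F, τ x ^ q = x) :
    a.comp b = (∑ i ∈ Finset.range sstar, (qFragment q sstar a i).comp b) ∧
      ∀ i < sstar, ∀ h ≤ s + sstar - 1,
        τ^[i * sstar] (((qFragment q sstar a i).comp b).coeff (q ^ (i * sstar + h))) =
          ∑ j ∈ Finset.range (h + 1),
            τ^[i * sstar] ((qFragment q sstar a i).coeff (q ^ (i * sstar + j))) *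
              b.coeff (q ^ (h - j)) ^ q ^ j := by
  have hq1 : 1 < p ^ nn := Nat.one_lt_pow hn.ne' (Fact.out : p.Prime).one_lt
  subst hq
  have : CharP F p := charP_of_card_eq_prime_pow (f := nn * m) (by rw [hF, pow_mul])
  constructor
  · have hlt : a.natDegree < (p ^ nn) ^ (sstar * sstar) :=
      hda.trans_lt (Nat.pow_lt_pow_right hq1 (by rw [← sq]; exact hsstar.1))
    rw [← Polynomial.sum_comp, sum_range_qFragment, ← ha.eq_sum_monomial hq1 hlt]
  · intro i _ h _
    apply iterateFrobenius_inj F p (nn * (i * sstar))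
    simp only [map_sum, map_mul, iterateFrobenius_def, pow_mul p nn, iterate_pow_qpow hτ,
      coeff_qFragment_comp p nn hn]
    refine Finset.sum_congr rfl fun j _ => ?_
    rw [← pow_mul (b.coeff _) ((p ^ nn) ^ j), ← pow_add, add_comm j]
end
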